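/- arXiv:1807.08886 — 7 statements merged into one kernel-verified Lean document; each statement's English description precedes it below -/
import Mathlib

section
/- Let 0 < a < 1 be a real number and n ≥ 1. Let k₁ ≥ k₂ ≥ … ≥ k_n and ℓ₁ ≥ ℓ₂ ≥ … ≥ ℓ_n be non-negative integers satisfying: (i) for every j ≤ n, Σ_{i=1}^{j} k_i ≤ Σ_{i=1}^{j} ℓ_i, and (ii) Σ_{i=1}^{n} k_i = Σ_{i=1}^{n} ℓ_i. Let X = Σ_{i=1}^{n} X_i where X₁, …, X_n are independent {0,1}-valued random variables with P[X_i = 1] = a^{k_i}, and let Y = Σ_{i=1}^{n} Y_i where Y₁, …, Y_n are independent {0,1}-valued random variables with P[Y_i = 1] = a^{ℓ_i}. Then for every integer M, P[X ≥ M] ≤ P[Y ≥ M]. -/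
open Finset

/-- The expectation of `f (∑ i ∈ s, Xᵢ)` for independent indicators `Xᵢ` with success
probabilities `p i`. -/
def indicatorSumExpectation {ι : Type*} [DecidableEq ι] (s : Finset ι) (p : ι → ℝ)
    (f : ℕ → ℝ) : ℝ :=
  ∑ t ∈ s.powerset, ((∏ i ∈ t, p i) * ∏ i ∈ s \ t, (1 - p i)) * f t.card

section indicatorSumExpectation

variable {ι : Type*} [DecidableEq ι]

theorem indicatorSumExpectation_insert {s : Finset ι} {i : ι} (hi : i ∉ s) (p : ι → ℝ)
    (f : ℕ → ℝ) :
    indicatorSumExpectation (insert i s) p f =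
      (1 - p i) * indicatorSumExpectation s p f +
        p i * indicatorSumExpectation s p (fun m => f (m + 1)) := by
  unfold indicatorSumExpectation
  rw [sum_powerset_insert hi, mul_sum, mul_sum]
  congr 1 <;> refine sum_congr rfl fun t ht => ?_
  · have hit : i ∉ t := fun h => hi (mem_powerset.1 ht h)
    rw [insert_sdiff_of_notMem _ hit, prod_insert (fun h => hi (mem_sdiff.1 h).1)]
    ring
  · have hit : i ∉ t := fun h => hi (mem_powerset.1 ht h)
    rw [insert_sdiff_insert, sdiff_insert_of_notMem hi, prod_insert hit,
      card_insert_of_notMem hit]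
    ring

theorem indicatorSumExpectation_mono (s : Finset ι) {p : ι → ℝ} (h0 : ∀ i, 0 ≤ p i)
    (h1 : ∀ i, p i ≤ 1) {f g : ℕ → ℝ} (hfg : ∀ m, f m ≤ g m) :
    indicatorSumExpectation s p f ≤ indicatorSumExpectation s p g :=
  sum_le_sum fun _ _ => mul_le_mul_of_nonneg_left (hfg _) <|
    mul_nonneg (prod_nonneg fun i _ => h0 i) (prod_nonneg fun i _ => sub_nonneg.2 (h1 i))

theorem indicatorSumExpectation_congr {s : Finset ι} {p q : ι → ℝ} (h : ∀ i ∈ s, p i = q i)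
    (f : ℕ → ℝ) : indicatorSumExpectation s p f = indicatorSumExpectation s q f := by
  refine sum_congr rfl fun t ht => ?_
  rw [prod_congr (rfl : t = t) fun i hi => h i (mem_powerset.1 ht hi),
    prod_congr (rfl : s \ t = s \ t) fun i hi => congrArg (1 - ·) (h i (mem_sdiff.1 hi).1)]

/-- Changing two success probabilities so that their product is kept and their sum grows
increases the expectation of every monotone function of the number of successes. -/
theorem indicatorSumExpectation_le_of_pair [Fintype ι] {p q : ι → ℝ} {i j : ι} (hij : i ≠ j)
    (h0 : ∀ m, 0 ≤ p m) (h1 : ∀ m, p m ≤ 1) (hpq : ∀ m, m ≠ i → m ≠ j → p m = q m)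
    (hmul : p i * p j = q i * q j) (hadd : p i + p j ≤ q i + q j)
    {f : ℕ → ℝ} (hf : Monotone f) :
    indicatorSumExpectation univ p f ≤ indicatorSumExpectation univ q f := by
  have hu : (univ : Finset ι) = insert i (insert j (univ \ {i, j})) := by
    ext m; simp; tauto
  have hj : j ∉ (univ \ {i, j} : Finset ι) := by simp
  have hi : i ∉ insert j (univ \ {i, j} : Finset ι) := by simp [hij]
  have hs : ∀ m ∈ (univ \ {i, j} : Finset ι), p m = q m := fun m hm => by
    simp only [mem_sdiff, mem_univ, mem_insert, mem_singleton, true_and, not_or] at hm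
    exact hpq m hm.1 hm.2
  rw [hu]
  simp only [indicatorSumExpectation_insert hi, indicatorSumExpectation_insert hj,
    ← indicatorSumExpectation_congr hs]
  have hmono := indicatorSumExpectation_mono (univ \ {i, j}) h0 h1 fun m => hf (Nat.le_succ m)
  simp only [Nat.succ_eq_add_one] at hmono
  generalize indicatorSumExpectation _ p f = A at *
  generalize indicatorSumExpectation _ p (fun m => f (m + 1)) = B at *
  generalize indicatorSumExpectation _ p _ = C at *
  linear_combination (A - 2 * B + C) * hmul + mul_nonneg (sub_nonneg.2 hadd) (sub_nonneg.2 hmono)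

/-- The expectation of a monotone function of the number of successes is monotone in the
exponents of the success probabilities with respect to majorization. -/
theorem indicatorSumExpectation_pow_le_of_majorized [Fintype ι] [LinearOrder ι] {a : ℝ}
    (ha0 : 0 ≤ a) (ha1 : a ≤ 1) {k : ι → ℕ} (hk : Antitone k) {f : ℕ → ℝ} (hf : Monotone f)
    (l : ι → ℕ)
    (hpre : ∀ j : ι, ∑ i ∈ univ.filter (· ≤ j), k i ≤ ∑ i ∈ univ.filter (· ≤ j), l i)
    (htot : ∑ i, k i = ∑ i, l i) :
    indicatorSumExpectation univ (fun i => a ^ k i) f ≤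
      indicatorSumExpectation univ (fun i => a ^ l i) f := by
  induction hN : ∑ i, (l i - k i) using Nat.strong_induction_on generalizing l with
  | _ N ih =>
  by_cases hex : ∃ j, l j < k j
  swap
  · push Not at hex
    have hkl : k = l := funext fun i =>
      (sum_eq_sum_iff_of_le fun i _ => hex i).1 htot i (mem_univ i)
    rw [hkl]
  obtain ⟨j, hj, hjmin⟩ : ∃ j, l j < k j ∧ ∀ m < j, k m ≤ l m := by
    obtain ⟨j, hj⟩ := (Set.toFinite {j | l j < k j}).exists_minimal hex
    exact ⟨j, hj.1, fun m hm => not_lt.1 fun h => hj.not_lt h hm⟩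
  obtain ⟨i, hi, hilt⟩ : ∃ i ≤ j, k i < l i := by
    by_contra! h
    refine (hpre j).not_gt (sum_lt_sum (fun i hi => h i (mem_filter.1 hi).2) ⟨j, ?_, hj⟩)
    simp
  have hij : i < j := lt_of_le_of_ne hi (by rintro rfl; omega)
  have hkij := hk hi
  let l' : ι → ℕ := Function.update (Function.update l i (l i - 1)) j (l j + 1)
  have hl'i : l' i = l i - 1 := by simp [l', hij.ne]
  have hl'j : l' j = l j + 1 := by simp [l']
  have hl'm : ∀ m, m ≠ i → m ≠ j → l' m = l m := fun m h h' => by simp [l', h, h']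
  have hl' : ∀ m, l' m + (if m = i then 1 else 0) = l m + if m = j then 1 else 0 := by
    intro m
    by_cases hmi : m = i
    · subst hmi; simp [hl'i, hij.ne]; omega
    by_cases hmj : m = j
    · subst hmj; simp [hl'j, hij.ne']
    · simp [hl'm m hmi hmj, hmi, hmj]
  have hsum : ∀ s : Finset ι, ∑ m ∈ s, l' m + (if i ∈ s then 1 else 0) =
      ∑ m ∈ s, l m + if j ∈ s then 1 else 0 := by
    intro s
    have := sum_congr (rfl : s = s) fun m _ => hl' m
    simpa only [sum_add_distrib, sum_ite_eq'] using this
  refine (ih (∑ m, (l' m - k m)) ?_ l' ?_ ?_ rfl).trans ?_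
  · rw [← hN]
    refine sum_lt_sum (fun m _ => ?_) ⟨i, mem_univ i, by omega⟩
    by_cases hmi : m = i
    · subst hmi; omega
    by_cases hmj : m = j
    · subst hmj; omega
    · rw [hl'm m hmi hmj]
  · intro m
    have h := hsum (univ.filter (· ≤ m))
    simp only [mem_filter, mem_univ, true_and] at h
    have hm := hpre m
    by_cases hjm : j ≤ m
    · simp only [hjm, hi.trans hjm, if_true] at h
      omega
    by_cases him : i ≤ m
    · have hlt : ∑ i ∈ univ.filter (· ≤ m), k i < ∑ i ∈ univ.filter (· ≤ m), l i :=
        sum_lt_sum (fun r hr => hjmin r ((mem_filter.1 hr).2.trans_lt (not_le.1 hjm)))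
          ⟨i, by simpa using him, hilt⟩
      simp only [hjm, him, if_true, if_false] at h
      omega
    · simp only [hjm, him, if_false] at h
      omega
  · have h := hsum univ
    simp only [mem_univ, if_true] at h
    omega
  · refine indicatorSumExpectation_le_of_pair hij.ne (fun m => pow_nonneg ha0 _)
      (fun m => pow_le_one₀ ha0 ha1) (fun m h h' => by rw [hl'm m h h']) ?_ ?_ hf
    · rw [← pow_add, ← pow_add]
      congr 1
      omega
    · obtain ⟨x, hx⟩ : ∃ x, l i = x + 1 := ⟨l i - 1, by omega⟩
      have hle : a ^ x ≤ a ^ l j := pow_le_pow_of_le_one ha0 ha1 (by omega)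
      simp only [hl'i, hl'j, hx, Nat.add_sub_cancel, pow_succ]
      linear_combination mul_nonneg (sub_nonneg.2 ha1) (sub_nonneg.2 hle)

theorem sum_bool_prod_eq_indicatorSumExpectation [Fintype ι] (p : ι → ℝ) (P : ℕ → Prop)
    [DecidablePred P] :
    ∑ ω ∈ univ.filter (fun ω : ι → Bool => P (univ.filter fun i => ω i = true).card),
        ∏ i, (if ω i = true then p i else 1 - p i) =
      indicatorSumExpectation univ p (fun m => if P m then 1 else 0) := by
  rw [sum_filter, indicatorSumExpectation, powerset_univ]
  refine sum_bij' (fun ω _ => univ.filter fun i => ω i = true) (fun t _ i => decide (i ∈ t))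
    (by simp) (by simp) (by simp) (by simp) fun ω _ => ?_
  rw [prod_ite, mul_ite, mul_one, mul_zero, ← filter_not]

end indicatorSumExpectation

/-- **Stochastic domination for sums of Bernoulli indicators with geometric success
probabilities.**  Let `0 < a < 1`, and let `k₁ ≥ … ≥ k_n` and `ℓ₁ ≥ … ≥ ℓ_n` be non-negative
integers with all prefix sums of `k` at most the corresponding prefix sums of `ℓ`, and equal
total sums.  If `X = Σ Xᵢ` and `Y = Σ Yᵢ` are sums of independent indicator random variables
with `P[Xᵢ = 1] = a^{kᵢ}` and `P[Yᵢ = 1] = a^{ℓᵢ}`, then `P[X ≥ M] ≤ P[Y ≥ M]` for every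
integer `M`.  The probabilities are written out explicitly over the sample space
`Fin n → Bool` of joint outcomes of the independent indicators. -/
theorem bernoulli_sum_domination (a : ℝ) (ha0 : 0 < a) (ha1 : a < 1)
    (n : ℕ) (hn : 1 ≤ n) (k l : Fin n → ℕ) (hk : Antitone k) (hl : Antitone l)
    (hpre : ∀ j : Fin n,
      ∑ i ∈ Finset.univ.filter (· ≤ j), k i ≤ ∑ i ∈ Finset.univ.filter (· ≤ j), l i)
    (htot : ∑ i, k i = ∑ i, l i) (M : ℤ) :
    ∑ ω ∈ Finset.univ.filter
        (fun ω : Fin n → Bool =>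
          M ≤ ((Finset.univ.filter fun i => ω i = true).card : ℤ)),
        ∏ i, (if ω i = true then a ^ k i else 1 - a ^ k i) ≤
    ∑ ω ∈ Finset.univ.filter
        (fun ω : Fin n → Bool =>
          M ≤ ((Finset.univ.filter fun i => ω i = true).card : ℤ)),
        ∏ i, (if ω i = true then a ^ l i else 1 - a ^ l i) := by
  rw [sum_bool_prod_eq_indicatorSumExpectation _ fun m : ℕ => M ≤ (m : ℤ),
    sum_bool_prod_eq_indicatorSumExpectation _ fun m : ℕ => M ≤ (m : ℤ)]
  refine indicatorSumExpectation_pow_le_of_majorized ha0.le ha1.le hk (fun x y hxy => ?_) l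
    hpre htot
  split_ifs <;> first | omega | norm_num
end

section
/- Let N ≥ 1 and let G be a bipartite graph with bipartition (L, R) where |L| = |R| = N, in which every vertex has degree at least 2N/3. Then G has a perfect matching, and for every edge e of G, N times the number of perfect matchings of G that contain e is at most 3 times the total number of perfect matchings of G. Equivalently, a uniformly random perfect matching of G contains any fixed edge e with probability at most 3/N. -/
open Finset

section BipartiteRelation

variable {α β : Type*} [Fintype α] [Fintype β] [DecidableEq α] [DecidableEq β]

theorem exists_equiv_of_two_mul_card_le_three_mul_degree (r : α → β → Prop)
    [∀ a, DecidablePred (r a)] [∀ b, DecidablePred (r · b)]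
    (hcard : Fintype.card α = Fintype.card β)
    (hα : ∀ a, 2 * Fintype.card α ≤ 3 * #{b | r a b})
    (hβ : ∀ b, 2 * Fintype.card α ≤ 3 * #{a | r a b}) :
    ∃ σ : α ≃ β, ∀ a, r a (σ a) := by
  have hall : ∀ S : Finset α, #S ≤ #(S.biUnion fun a => ({b | r a b} : Finset β)) := by
    intro S
    rcases S.eq_empty_or_nonempty with rfl | ⟨a, ha⟩
    · simp
    have hN : 0 < Fintype.card α := Fintype.card_pos_iff.mpr ⟨a⟩
    by_cases hS : 3 * #S ≤ 2 * Fintype.card α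
    · have := card_le_card (subset_biUnion_of_mem (fun a => ({b | r a b} : Finset β)) ha)
      have := hα a
      lia
    · suffices (S.biUnion fun a => ({b | r a b} : Finset β)) = univ by
        rw [this, card_univ, ← hcard]
        exact card_le_univ S
      refine eq_univ_iff_forall.mpr fun b => ?_
      have hb := hβ b
      have hdisj : ¬ Disjoint S ({a | r a b} : Finset α) := fun h => by
        have h1 := card_union_of_disjoint h
        have h2 := card_le_univ (S ∪ ({a | r a b} : Finset α))
        lia
      obtain ⟨x, hxS, hx⟩ := not_disjoint_iff.mp hdisj
      exact mem_biUnion.mpr ⟨x, hxS, by simpa using hx⟩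
  obtain ⟨f, hf, hfr⟩ := (all_card_le_biUnion_card_iff_exists_injective _).mp hall
  exact ⟨Equiv.ofBijective f ((Fintype.bijective_iff_injective_and_card f).mpr ⟨hf, hcard⟩),
    fun a => by simpa using hfr a⟩

/-- Switching: composing `σ` with a transposition `swap a x` maps pairs `(σ, x)` with `σ a = b`
injectively to all matchings. -/
theorem card_mul_card_equiv_apply_eq_le (r : α → β → Prop)
    [∀ a, DecidablePred (r a)] [∀ b, DecidablePred (r · b)] (a : α) (b : β)
    (ha : 2 * Fintype.card α ≤ 3 * #{y | r a y})
    (hb : 2 * Fintype.card α ≤ 3 * #{x | r x b}) :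
    Fintype.card α * #{σ : α ≃ β | (∀ x, r x (σ x)) ∧ σ a = b} ≤
      3 * #{σ : α ≃ β | ∀ x, r x (σ x)} := by
  set A : Finset (α ≃ β) := {σ | (∀ x, r x (σ x)) ∧ σ a = b}
  let X : (α ≃ β) → Finset α := fun σ => {x | r a (σ x) ∧ r x b}
  have hX : ∀ σ ∈ A, Fintype.card α ≤ 3 * #(X σ) := by
    intro σ _
    have h1 : #({x | r a (σ x)} : Finset α) = #({y | r a y} : Finset β) :=
      card_bij (fun x _ => σ x) (by simp) (by simp)
        (fun y hy => ⟨σ.symm y, by simpa using hy, by simp⟩)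
    have h2 := card_union_add_card_inter ({x | r a (σ x)} : Finset α) ({x | r x b} : Finset α)
    rw [← filter_and] at h2
    have h3 := card_le_univ (({x | r a (σ x)} : Finset α) ∪ ({x | r x b} : Finset α))
    change _ ≤ 3 * #({x | r a (σ x) ∧ r x b} : Finset α)
    lia
  have hinj : #(A.sigma X) ≤ #{σ : α ≃ β | ∀ x, r x (σ x)} := by
    refine card_le_card_of_injOn (fun p => (Equiv.swap a p.2).trans p.1) ?_ ?_
    · rintro ⟨σ, x⟩ hp
      simp only [A, X, coe_sigma, Set.mem_sigma_iff, mem_coe, mem_filter, mem_univ,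
        true_and] at hp
      obtain ⟨⟨hσ, hab⟩, hax, hxb⟩ := hp
      simp only [mem_coe, mem_filter, mem_univ, true_and, Equiv.trans_apply]
      intro z
      rcases eq_or_ne z a with rfl | hza
      · simpa using hax
      rcases eq_or_ne z x with rfl | hzx
      · simpa [hab] using hxb
      · simpa [Equiv.swap_apply_of_ne_of_ne hza hzx] using hσ z
    · rintro ⟨σ, x⟩ hp ⟨τ, y⟩ hq h
      simp only [A, X, coe_sigma, Set.mem_sigma_iff, mem_coe, mem_filter, mem_univ,
        true_and] at hp hq
      have hσ : σ.symm b = a := by rw [← hp.1.2, Equiv.symm_apply_apply]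
      have hτ : τ.symm b = a := by rw [← hq.1.2, Equiv.symm_apply_apply]
      have hxy : x = y := by
        simpa [hσ, hτ] using congrArg (fun ρ : α ≃ β => ρ.symm b) h
      subst hxy
      have hστ : σ = τ := by
        ext z
        simpa using congrArg (fun ρ : α ≃ β => ρ (Equiv.swap a x z)) h
      rw [hστ]
  calc Fintype.card α * #A = ∑ σ ∈ A, Fintype.card α := by rw [sum_const, smul_eq_mul, mul_comm]
    _ ≤ ∑ σ ∈ A, 3 * #(X σ) := sum_le_sum hX
    _ = 3 * #(A.sigma X) := by rw [card_sigma, mul_sum]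
    _ ≤ _ := Nat.mul_le_mul_left 3 hinj

end BipartiteRelation

namespace SimpleGraph

variable {α β : Type*} {G : SimpleGraph (α ⊕ β)}

/-- The subgraph of a graph on `α ⊕ β` whose edges join each `a` to `σ a`. -/
def subgraphOfEquiv (σ : α ≃ β) (hσ : ∀ a, G.Adj (.inl a) (.inr (σ a))) : G.Subgraph where
  verts := Set.univ
  Adj
    | .inl a, .inr b => σ a = b
    | .inr b, .inl a => σ a = b
    | _, _ => False
  adj_sub := by
    rintro (a | b) (a' | b') h
    · exact h.elim
    · exact h ▸ hσ a
    · exact h ▸ (hσ a').symm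
    · exact h.elim
  edge_vert _ := Set.mem_univ _
  symm := ⟨by rintro (a | b) (a' | b') h <;> exact h⟩

theorem subgraphOfEquiv_isPerfectMatching (σ : α ≃ β) (hσ : ∀ a, G.Adj (.inl a) (.inr (σ a))) :
    (subgraphOfEquiv σ hσ).IsPerfectMatching := by
  rw [Subgraph.isPerfectMatching_iff]
  rintro (a | b)
  · refine ⟨.inr (σ a), rfl, ?_⟩
    rintro (a' | b') h
    · exact h.elim
    · exact congrArg _ (Eq.symm h)
  · refine ⟨.inl (σ.symm b), σ.apply_symm_apply b, ?_⟩
    rintro (a' | b') h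
    · exact congrArg _ (σ.eq_symm_apply.mpr h)
    · exact h.elim

theorem exists_subgraphOfEquiv_eq
    (hα : ∀ a a' : α, ¬ G.Adj (.inl a) (.inl a')) (hβ : ∀ b b' : β, ¬ G.Adj (.inr b) (.inr b'))
    {M : G.Subgraph} (hM : M.IsPerfectMatching) :
    ∃ (σ : α ≃ β) (hσ : ∀ a, G.Adj (.inl a) (.inr (σ a))), subgraphOfEquiv σ hσ = M := by
  rw [Subgraph.isPerfectMatching_iff] at hM
  have hl : ∀ a, ∃ b, M.Adj (.inl a) (.inr b) := fun a => by
    obtain ⟨a' | b, h, -⟩ := hM (.inl a)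
    · exact (hα _ _ h.adj_sub).elim
    · exact ⟨b, h⟩
  have hr : ∀ b, ∃ a, M.Adj (.inl a) (.inr b) := fun b => by
    obtain ⟨a | b', h, -⟩ := hM (.inr b)
    · exact ⟨a, h.symm⟩
    · exact (hβ _ _ h.adj_sub).elim
  choose f hf using hl
  choose g hg using hr
  have hfb : ∀ {a b}, M.Adj (.inl a) (.inr b) → f a = b := fun h =>
    Sum.inr_injective ((hM _).unique (hf _) h)
  have hga : ∀ {a b}, M.Adj (.inl a) (.inr b) → g b = a := fun h =>
    Sum.inl_injective ((hM _).unique (hg _).symm h.symm)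
  refine ⟨⟨f, g, fun a => hga (hf a), fun b => hfb (hg b)⟩, fun a => (hf a).adj_sub, ?_⟩
  ext u v
  · simpa [subgraphOfEquiv] using (hM u).exists.choose_spec.fst_mem
  · rcases u with a | b <;> rcases v with a' | b'
    · exact ⟨False.elim, fun h => hα _ _ h.adj_sub⟩
    · exact ⟨fun h => (show f a = b' from h) ▸ hf a, hfb⟩
    · exact ⟨fun h => (show f a' = b from h) ▸ (hf a').symm, fun h => hfb h.symm⟩
    · exact ⟨False.elim, fun h => hβ _ _ h.adj_sub⟩

/-- Perfect matchings of a bipartite graph on `α ⊕ β` correspond to equivalences `α ≃ β` along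
edges. -/
noncomputable def equivPerfectMatching
    (hα : ∀ a a' : α, ¬ G.Adj (.inl a) (.inl a')) (hβ : ∀ b b' : β, ¬ G.Adj (.inr b) (.inr b')) :
    {σ : α ≃ β // ∀ a, G.Adj (.inl a) (.inr (σ a))} ≃ {M : G.Subgraph // M.IsPerfectMatching} :=
  Equiv.ofBijective
    (fun σ => ⟨subgraphOfEquiv σ.1 σ.2, subgraphOfEquiv_isPerfectMatching σ.1 σ.2⟩) <| by
    refine ⟨fun σ τ h => Subtype.ext (Equiv.ext fun a => ?_), fun M => ?_⟩
    · have h' : subgraphOfEquiv σ.1 σ.2 = subgraphOfEquiv τ.1 τ.2 := congrArg Subtype.val h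
      have : (subgraphOfEquiv τ.1 τ.2).Adj (.inl a) (.inr (σ.1 a)) := h' ▸ rfl
      exact Eq.symm this
    · obtain ⟨σ, hσ, h⟩ := exists_subgraphOfEquiv_eq hα hβ M.2
      exact ⟨⟨σ, hσ⟩, Subtype.ext h⟩

theorem mem_edgeSet_equivPerfectMatching
    (hα : ∀ a a' : α, ¬ G.Adj (.inl a) (.inl a')) (hβ : ∀ b b' : β, ¬ G.Adj (.inr b) (.inr b'))
    (σ : {σ : α ≃ β // ∀ a, G.Adj (.inl a) (.inr (σ a))}) (a : α) (b : β) :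
    s(.inl a, .inr b) ∈ (equivPerfectMatching hα hβ σ).1.edgeSet ↔ σ.1 a = b :=
  Iff.rfl

variable [Fintype α] [Fintype β] [DecidableRel G.Adj]

theorem degree_inl_eq_card (hα : ∀ a a' : α, ¬ G.Adj (.inl a) (.inl a')) (a : α) :
    G.degree (.inl a) = #{b : β | G.Adj (.inl a) (.inr b)} := by
  rw [← card_neighborFinset_eq_degree, ← card_map (Function.Embedding.inr : β ↪ α ⊕ β)]
  congr 1
  ext (a' | b) <;> simp [hα]

theorem degree_inr_eq_card (hβ : ∀ b b' : β, ¬ G.Adj (.inr b) (.inr b')) (b : β) :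
    G.degree (.inr b) = #{a : α | G.Adj (.inl a) (.inr b)} := by
  rw [← card_neighborFinset_eq_degree, ← card_map (Function.Embedding.inl : α ↪ α ⊕ β)]
  congr 1
  ext (a | b') <;> simp [hβ, G.adj_comm]

end SimpleGraph


/-- **Random perfect matchings in dense bipartite graphs.**  Let `G` be a bipartite graph with
parts `L` and `R` of size `N` each (modeled on the vertex type `Fin N ⊕ Fin N`, with no edges
inside either part), in which every vertex has degree at least `2N/3`.  Then `G` has a perfect
matching, and for every edge `e` of `G`, `N` times the number of perfect matchings containing
`e` is at most `3` times the total number of perfect matchings; i.e. a uniformly random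
perfect matching contains `e` with probability at most `3/N`. -/
theorem bipartite_random_matching_edge_probability (N : ℕ) (hN : 1 ≤ N)
    (G : SimpleGraph (Fin N ⊕ Fin N)) [DecidableRel G.Adj]
    (hbip : ∀ a b : Fin N,
      ¬ G.Adj (Sum.inl a) (Sum.inl b) ∧ ¬ G.Adj (Sum.inr a) (Sum.inr b))
    (hdeg : ∀ v, (2 * N : ℝ) / 3 ≤ (G.degree v : ℝ)) :
    (∃ M : G.Subgraph, M.IsPerfectMatching) ∧
    ∀ e ∈ G.edgeSet,
      N * Nat.card {M : G.Subgraph // M.IsPerfectMatching ∧ e ∈ M.edgeSet} ≤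
        3 * Nat.card {M : G.Subgraph // M.IsPerfectMatching} := by
  have hl := fun a b => (hbip a b).1
  have hr := fun a b => (hbip a b).2
  have hdeg' : ∀ v, 2 * N ≤ 3 * G.degree v := fun v => by
    have := hdeg v
    have h : (2 * N : ℝ) ≤ 3 * G.degree v := by linarith
    exact_mod_cast h
  have hL : ∀ a, 2 * Fintype.card (Fin N) ≤ 3 * #{b | G.Adj (.inl a) (.inr b)} := fun a => by
    rw [Fintype.card_fin, ← SimpleGraph.degree_inl_eq_card hl]
    exact hdeg' _
  have hR : ∀ b, 2 * Fintype.card (Fin N) ≤ 3 * #{a | G.Adj (.inl a) (.inr b)} := fun b => by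
    rw [Fintype.card_fin, ← SimpleGraph.degree_inr_eq_card hr]
    exact hdeg' _
  constructor
  · obtain ⟨σ, hσ⟩ := exists_equiv_of_two_mul_card_le_three_mul_degree
      (fun a b => G.Adj (.inl a) (.inr b)) rfl hL hR
    exact ⟨_, SimpleGraph.subgraphOfEquiv_isPerfectMatching σ hσ⟩
  have key : ∀ a b, N * Nat.card {M : G.Subgraph // M.IsPerfectMatching ∧
      s(.inl a, .inr b) ∈ M.edgeSet} ≤ 3 * Nat.card {M : G.Subgraph // M.IsPerfectMatching} := by
    intro a b
    let E := SimpleGraph.equivPerfectMatching hl hr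
    have hM : Nat.card {M : G.Subgraph // M.IsPerfectMatching} =
        #{σ : Fin N ≃ Fin N | ∀ x, G.Adj (.inl x) (.inr (σ x))} := by
      rw [← Nat.card_congr E, Nat.card_eq_fintype_card, Fintype.card_subtype]
    have hMe : Nat.card {M : G.Subgraph // M.IsPerfectMatching ∧ s(.inl a, .inr b) ∈ M.edgeSet} =
        #{σ : Fin N ≃ Fin N | (∀ x, G.Adj (.inl x) (.inr (σ x))) ∧ σ a = b} := by
      rw [← Fintype.card_subtype, ← Nat.card_eq_fintype_card]
      exact Nat.card_congr <|
        (Equiv.subtypeSubtypeEquivSubtypeInter _ _).symm.trans <|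
          (E.subtypeEquiv fun σ =>
            (SimpleGraph.mem_edgeSet_equivPerfectMatching hl hr σ a b).symm).symm.trans <|
          Equiv.subtypeSubtypeEquivSubtypeInter _ fun σ : Fin N ≃ Fin N => σ a = b
    rw [hM, hMe]
    have h := card_mul_card_equiv_apply_eq_le
      (fun a b => G.Adj (.inl a) (.inr b)) a b (hL a) (hR b)
    rw [Fintype.card_fin] at h
    convert h
  intro e
  induction e using Sym2.ind with
  | _ u v =>
    rw [SimpleGraph.mem_edgeSet]
    intro h
    rcases u with a | b <;> rcases v with a' | b'
    · exact (hl _ _ h).elim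
    · exact key a b'
    · rw [Sym2.eq_swap]
      exact key a' b
    · exact (hr _ _ h).elim
end

section
/- Let n be an even positive integer and let G be a simple graph on n vertices in which every vertex has at least n − √n/4000 neighbors. Then for every edge e of G, (n − √n/1000) times the number of perfect matchings of G that contain e is at most the total number of perfect matchings of G. Equivalently, a uniformly random perfect matching of G contains any fixed edge e with probability at most 1/(n − √n/1000). -/
namespace SimpleGraph

variable {V : Type*} {G : SimpleGraph V}

namespace Subgraph

/-- Exchanging the roles of `v` and `x` in `M`, where the matching edges `u v` and `x y` are
replaced by the edges `u x` and `v y` of `G`. -/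
def switch [DecidableEq V] (M : G.Subgraph) (hM : M.IsPerfectMatching) {u v x y : V}
    (huv : M.Adj u v) (hxy : M.Adj x y) (hux : G.Adj u x) (hvy : G.Adj v y) : G.Subgraph where
  verts := Set.univ
  Adj a b := M.Adj (Equiv.swap v x a) (Equiv.swap v x b)
  adj_sub {a b} h := by
    have partner_v {c : V} (hc : M.Adj v c) : c = u := hM.1.eq_of_adj_left hc huv.symm
    have partner_x {c : V} (hc : M.Adj x c) : c = y := hM.1.eq_of_adj_left hc hxy
    have hu : Equiv.swap v x u = u :=
      Equiv.swap_apply_of_ne_of_ne (M.adj_sub huv).ne hux.ne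
    have hy : Equiv.swap v x y = y :=
      Equiv.swap_apply_of_ne_of_ne hvy.ne' (M.adj_sub hxy).ne'
    have key {a b : V} (ha : a = v ∨ a = x)
        (h : M.Adj (Equiv.swap v x a) (Equiv.swap v x b)) : G.Adj a b := by
      rcases ha with rfl | rfl
      · rw [Equiv.swap_apply_left] at h
        have hb := partner_x h
        rw [← hy, (Equiv.swap _ _).injective.eq_iff] at hb
        exact hb ▸ hvy
      · rw [Equiv.swap_apply_right] at h
        have hb := partner_v h
        rw [← hu, (Equiv.swap _ _).injective.eq_iff] at hb
        exact hb ▸ hux.symm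
    by_cases ha : a = v ∨ a = x
    · exact key ha h
    by_cases hb : b = v ∨ b = x
    · exact (key hb h.symm).symm
    push Not at ha hb
    rw [Equiv.swap_apply_of_ne_of_ne ha.1 ha.2, Equiv.swap_apply_of_ne_of_ne hb.1 hb.2] at h
    exact h.adj_sub
  edge_vert _ := Set.mem_univ _
  symm := ⟨fun _ _ h => Subgraph.Adj.symm h⟩

variable [DecidableEq V] {M : G.Subgraph} {u v x y : V}

lemma switch_isPerfectMatching (hM : M.IsPerfectMatching) (huv : M.Adj u v) (hxy : M.Adj x y)
    (hux : G.Adj u x) (hvy : G.Adj v y) :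
    (M.switch hM huv hxy hux hvy).IsPerfectMatching := by
  rw [isPerfectMatching_iff] at hM ⊢
  intro a
  exact (Equiv.swap v x).bijective.existsUnique_iff.mp (hM (Equiv.swap v x a))

lemma switch_adj (hM : M.IsPerfectMatching) (huv : M.Adj u v) (hxy : M.Adj x y)
    (hux : G.Adj u x) (hvy : G.Adj v y) :
    (M.switch hM huv hxy hux hvy).Adj u x := by
  change M.Adj (Equiv.swap v x u) (Equiv.swap v x x)
  rwa [Equiv.swap_apply_right, Equiv.swap_apply_of_ne_of_ne huv.ne hux.ne]

lemma switch_injective {M' : G.Subgraph} {x' y' : V}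
    (hM : M.IsPerfectMatching) (huv : M.Adj u v) (hxy : M.Adj x y)
    (hux : G.Adj u x) (hvy : G.Adj v y)
    (hM' : M'.IsPerfectMatching) (huv' : M'.Adj u v) (hxy' : M'.Adj x' y')
    (hux' : G.Adj u x') (hvy' : G.Adj v y')
    (h : M.switch hM huv hxy hux hvy = M'.switch hM' huv' hxy' hux' hvy') :
    M = M' ∧ x = x' := by
  have hx : x = x' := by
    have h₁ := switch_adj hM huv hxy hux hvy
    rw [h] at h₁
    exact (switch_isPerfectMatching hM' huv' hxy' hux' hvy').1.eq_of_adj_left h₁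
      (switch_adj hM' huv' hxy' hux' hvy')
  subst hx
  refine ⟨Subgraph.ext ?_ ?_, rfl⟩
  · rw [hM.2.verts_eq_univ, hM'.2.verts_eq_univ]
  · ext a b
    have hab := congrArg (fun N : G.Subgraph => N.Adj (Equiv.swap v x a) (Equiv.swap v x b)) h
    simpa [switch] using hab

/-- In a perfect matching `M`, at least `G.degree u + G.degree v - Fintype.card V` neighbors of `u`
are matched to a neighbor of `v`. -/
lemma IsPerfectMatching.degree_add_degree_le [Fintype V] [DecidableRel G.Adj]
    (hM : M.IsPerfectMatching) (u v : V) :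
    G.degree u + G.degree v ≤
      Fintype.card V + Nat.card {x : V // G.Adj u x ∧ ∃ y, M.Adj x y ∧ G.Adj v y} := by
  classical
  choose p hp using fun a => (isPerfectMatching_iff.mp hM a).exists
  have hpp : Function.Involutive p := fun a =>
    hM.1.eq_of_adj_left (hp (p a)) (hp a).symm
  have hcard : ((G.neighborFinset v).image p).card = G.degree v := by
    rw [Finset.card_image_of_injective _ hpp.injective, card_neighborFinset_eq_degree]
  have hinter : Nat.card {x : V // G.Adj u x ∧ ∃ y, M.Adj x y ∧ G.Adj v y} =
      (G.neighborFinset u ∩ (G.neighborFinset v).image p).card := by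
    rw [Nat.card_eq_fintype_card]
    refine Fintype.card_of_subtype _ fun x => ?_
    simp only [Finset.mem_inter, mem_neighborFinset, Finset.mem_image]
    refine and_congr_right fun _ => ⟨?_, ?_⟩
    · rintro ⟨y, hvy, rfl⟩
      exact ⟨y, (hp y).symm, hvy⟩
    · rintro ⟨y, hxy, hvy⟩
      exact ⟨y, hvy, hM.1.eq_of_adj_left (hp y) hxy.symm⟩
  rw [hinter, ← hcard, ← card_neighborFinset_eq_degree, ← Finset.card_union_add_card_inter]
  gcongr
  exact Finset.card_le_univ _

end Subgraph

lemma degree_add_degree_mul_card_perfectMatchings_le [Fintype V] [DecidableEq V]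
    [DecidableRel G.Adj] (u v : V) :
    (G.degree u + G.degree v) * Nat.card {M : G.Subgraph // M.IsPerfectMatching ∧ M.Adj u v} ≤
      Fintype.card V * Nat.card {M : G.Subgraph // M.IsPerfectMatching ∧ M.Adj u v} +
        Nat.card {M : G.Subgraph // M.IsPerfectMatching} := by
  classical
  let A := {M : G.Subgraph // M.IsPerfectMatching ∧ M.Adj u v}
  let X (M : A) := {x : V // G.Adj u x ∧ ∃ y, M.1.Adj x y ∧ G.Adj v y}
  have : Fintype A := Fintype.ofFinite A
  let f (q : Σ M : A, X M) : {M : G.Subgraph // M.IsPerfectMatching} :=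
    ⟨_, Subgraph.switch_isPerfectMatching q.1.2.1 q.1.2.2 q.2.2.2.choose_spec.1 q.2.2.1
      q.2.2.2.choose_spec.2⟩
  have hf : Function.Injective f := by
    rintro ⟨⟨M, hM⟩, ⟨x, hx⟩⟩ ⟨⟨M', hM'⟩, ⟨x', hx'⟩⟩ h
    obtain ⟨rfl, rfl⟩ := Subgraph.switch_injective hM.1 hM.2 hx.2.choose_spec.1 hx.1
      hx.2.choose_spec.2 hM'.1 hM'.2 hx'.2.choose_spec.1 hx'.1 hx'.2.choose_spec.2
      (congrArg Subtype.val h)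
    rfl
  calc (G.degree u + G.degree v) * Nat.card A = ∑ _M : A, (G.degree u + G.degree v) := by
        rw [Finset.sum_const, Finset.card_univ, Nat.card_eq_fintype_card, smul_eq_mul, mul_comm]
    _ ≤ ∑ M : A, (Fintype.card V + Nat.card (X M)) :=
        Finset.sum_le_sum fun M _ => M.2.1.degree_add_degree_le u v
    _ = Fintype.card V * Nat.card A + Nat.card (Σ M : A, X M) := by
        rw [Finset.sum_add_distrib, Finset.sum_const, Finset.card_univ, Nat.card_sigma,
          Nat.card_eq_fintype_card, smul_eq_mul, mul_comm]
    _ ≤ _ := by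
        gcongr
        exact Nat.card_le_card_of_injective f hf

end SimpleGraph

/-- **Random perfect matchings in very dense graphs.**  Let `G` be a graph on an even number
`n` of vertices in which every vertex has at least `n - √n/4000` neighbors.  Then for every
edge `e` of `G`, `(n - √n/1000)` times the number of perfect matchings of `G` containing `e`
is at most the total number of perfect matchings of `G`; i.e. a uniformly random perfect
matching contains `e` with probability at most `1/(n - √n/1000)`. -/
theorem dense_random_matching_edge_probability (n : ℕ) (hn : 0 < n) (heven : Even n)
    (V : Type) [Fintype V] [DecidableEq V] (hcard : Fintype.card V = n)
    (G : SimpleGraph V) [DecidableRel G.Adj]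
    (hdeg : ∀ v : V, (n : ℝ) - Real.sqrt n / 4000 ≤ (G.degree v : ℝ)) :
    ∀ e ∈ G.edgeSet,
      ((n : ℝ) - Real.sqrt n / 1000) *
          (Nat.card {M : G.Subgraph // M.IsPerfectMatching ∧ e ∈ M.edgeSet} : ℝ) ≤
        (Nat.card {M : G.Subgraph // M.IsPerfectMatching} : ℝ) := by
  intro e
  induction e using Sym2.ind with
  | _ u v =>
    intro _
    simp only [SimpleGraph.Subgraph.mem_edgeSet]
    have h := G.degree_add_degree_mul_card_perfectMatchings_le u v
    rw [hcard] at h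
    set N := Nat.card {M : G.Subgraph // M.IsPerfectMatching ∧ M.Adj u v}
    have h' : ((G.degree u + G.degree v : ℝ)) * N ≤
        n * N + (Nat.card {M : G.Subgraph // M.IsPerfectMatching} : ℝ) := by
      exact_mod_cast h
    have hle : (n : ℝ) - Real.sqrt n / 1000 ≤ G.degree u + G.degree v - n := by
      linarith [hdeg u, hdeg v, Real.sqrt_nonneg (n : ℝ)]
    linarith [mul_le_mul_of_nonneg_right hle (Nat.cast_nonneg (α := ℝ) N)]
end

section
/- Let n ≥ 4 be an even integer and let G be a simple graph on n vertices in which every vertex has at least n − √n/4000 neighbors. For a uniformly random perfect matching M of G and vertices u, v, let P_v(u) denote the probability that the edge (u,v) is contained in M. Then for every vertex v, the number of vertices u with P_v(u) < 99/(100n) is at most √n/9. -/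
/-- Conjugating the map `f` by the transposition of `p` and `q`. -/
def conjSwap {V : Type*} [DecidableEq V] (p q : V) (f : V → V) : V → V :=
  fun x => Equiv.swap p q (f (Equiv.swap p q x))

/-- The map `f` sends every vertex to its partner in a perfect matching of `G`. -/
def IsPartnerMap {V : Type*} (G : SimpleGraph V) (f : V → V) : Prop :=
  ∀ x, G.Adj x (f x) ∧ f (f x) = x

section

variable {V : Type*}

theorem conjSwap_conjSwap [DecidableEq V] (p q : V) (f : V → V) :
    conjSwap p q (conjSwap p q f) = f := by
  funext x
  simp [conjSwap]

theorem conjSwap_involutive [DecidableEq V] {p q : V} {f : V → V} (hf : ∀ x, f (f x) = x) (x : V) :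
    conjSwap p q f (conjSwap p q f x) = x := by
  simp [conjSwap, hf]

/-- If `p` and `q` are not partners, conjugation exchanges their partners. -/
theorem conjSwap_apply [DecidableEq V] {p q : V} {f : V → V}
    (hf : ∀ x, f (f x) = x) (hfp : ∀ x, f x ≠ x)
    (hpq : f p ≠ q) (x : V) :
    conjSwap p q f x = if x = p then f q else if x = q then f p else if x = f p then q
      else if x = f q then p else f x := by
  have h1 := hf p
  have h2 := hf q
  have h3 := hfp p
  have h4 := hfp q
  have h5 := hf x
  simp only [conjSwap, Equiv.swap_apply_def]
  grind

theorem IsPartnerMap.conjSwap [DecidableEq V] {G : SimpleGraph V} {f : V → V}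
    (hf : IsPartnerMap G f) {p q : V}
    (hpq : f p ≠ q) (h1 : G.Adj p (f q)) (h2 : G.Adj q (f p)) :
    IsPartnerMap G (conjSwap p q f) := by
  intro x
  refine ⟨?_, conjSwap_involutive (fun x => (hf x).2) x⟩
  rw [conjSwap_apply (fun x => (hf x).2) (fun x => (hf x).1.ne') hpq]
  have := (hf x).1
  have := h1.symm
  have := h2.symm
  split_ifs <;> simp_all

theorem card_not_adj [Fintype V] {G : SimpleGraph V} [DecidableRel G.Adj] {d : ℕ}
    (hd : ∀ v, Fintype.card V ≤ G.degree v + d) (v : V) :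
    (Finset.univ.filter fun x => ¬ G.Adj v x).card ≤ d := by
  have h1 := Finset.card_filter_add_card_filter_not (s := Finset.univ) (fun x => G.Adj v x)
  have h2 : (Finset.univ.filter fun x => G.Adj v x).card = G.degree v := by
    rw [← SimpleGraph.card_neighborFinset_eq_degree, SimpleGraph.neighborFinset_eq_filter]
  have h3 := hd v
  rw [Finset.card_univ] at h1
  omega

/-- Few vertices `y` fail to allow exchanging the pairs `{w, b}`, `{y, f y}` for
`{w, y}`, `{b, f y}`. -/
theorem card_not_switchable [Fintype V] [DecidableEq V] {G : SimpleGraph V} [DecidableRel G.Adj]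
    {d : ℕ}
    (hd : ∀ v, Fintype.card V ≤ G.degree v + d) {f : V → V} (hf : ∀ x, f (f x) = x) (w b : V) :
    (Finset.univ.filter fun y => ¬ (G.Adj w y ∧ G.Adj b (f y))).card ≤ 2 * d := by
  have hsub : (Finset.univ.filter fun y => ¬ (G.Adj w y ∧ G.Adj b (f y))) ⊆
      (Finset.univ.filter fun x => ¬ G.Adj w x) ∪
        (Finset.univ.filter fun x => ¬ G.Adj b x).image f := by
    intro y hy
    simp only [Finset.mem_filter, Finset.mem_univ, true_and, Finset.mem_union,
      Finset.mem_image] at hy ⊢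
    by_cases h : G.Adj w y
    · exact Or.inr ⟨f y, fun h' => hy ⟨h, h'⟩, hf y⟩
    · exact Or.inl h
  have h1 := Finset.card_le_card hsub
  have h2 := Finset.card_union_le (Finset.univ.filter fun x => ¬ G.Adj w x)
    ((Finset.univ.filter fun x => ¬ G.Adj b x).image f)
  have h3 := Finset.card_image_le (s := Finset.univ.filter fun x => ¬ G.Adj b x) (f := f)
  have h4 := card_not_adj hd w
  have h5 := card_not_adj hd b
  omega

theorem exists_involutive_ne [Fintype V] (heven : Even (Fintype.card V)) :
    ∃ f : V → V, (∀ x, f (f x) = x) ∧ ∀ x, f x ≠ x := by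
  obtain ⟨m, hm⟩ := heven
  have e : V ≃ Fin m ⊕ Fin m := Fintype.equivOfCardEq (by simp [hm])
  refine ⟨fun x => e.symm (e x).swap, fun x => by simp, fun x h => ?_⟩
  have h' : (e x).swap = e x := by simpa [Equiv.symm_apply_eq] using h
  rcases hx : e x with a | a <;> simp [hx] at h'

theorem exists_isPartnerMap [Fintype V] [DecidableEq V] {G : SimpleGraph V} [DecidableRel G.Adj]
    {d : ℕ}
    (hd : ∀ v, Fintype.card V ≤ G.degree v + d) (h2d : 2 * d < Fintype.card V)
    (heven : Even (Fintype.card V)) : ∃ f, IsPartnerMap G f := by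
  classical
  obtain ⟨f, hf, hmin⟩ := Finset.exists_min_image
    (Finset.univ.filter fun f : V → V => (∀ x, f (f x) = x) ∧ ∀ x, f x ≠ x)
    (fun f => (Finset.univ.filter fun x => ¬ G.Adj x (f x)).card)
    (by
      obtain ⟨f, hf⟩ := exists_involutive_ne heven
      exact ⟨f, by simpa using hf⟩)
  simp only [Finset.mem_filter, Finset.mem_univ, true_and] at hf hmin
  obtain ⟨hinv, hne⟩ := hf
  refine ⟨f, fun v => ⟨?_, hinv v⟩⟩
  by_contra hv
  obtain ⟨y, hy⟩ : ∃ y, G.Adj v y ∧ G.Adj (f v) (f y) := by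
    by_contra! h
    have := card_not_switchable hd hinv v (f v)
    have huniv : (Finset.univ : Finset V) ⊆
        Finset.univ.filter fun y => ¬ (G.Adj v y ∧ G.Adj (f v) (f y)) :=
      fun y _ => by simpa using h y
    have := Finset.card_le_card huniv
    rw [Finset.card_univ] at this
    omega
  have hpq : f (f v) ≠ y := by rw [hinv]; exact hy.1.ne
  have happ := conjSwap_apply hinv hne hpq
  refine absurd (hmin (conjSwap (f v) y f) ⟨conjSwap_involutive hinv, fun x hx => ?_⟩) ?_
  · exact hne (Equiv.swap (f v) y x) ((Equiv.swap (f v) y).injective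
      (by simpa [conjSwap] using hx))
  · rw [not_le]
    apply Finset.card_lt_card
    rw [Finset.ssubset_iff_of_subset]
    · refine ⟨v, by simpa using hv, ?_⟩
      have := hy.1
      have := hne v
      simp only [Finset.mem_filter, Finset.mem_univ, true_and, happ, hinv]
      grind
    · intro x
      have := hy.1
      have := hy.2
      have := hy.1.symm
      have := hy.2.symm
      simp only [Finset.mem_filter, Finset.mem_univ, true_and, happ, hinv]
      grind

open scoped Classical in
/-- In few perfect matchings do `v` and `w` have distinct, non-adjacent partners. -/
theorem card_partners_not_adj [Fintype V] [DecidableEq V] {G : SimpleGraph V} [DecidableRel G.Adj]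
    {d : ℕ}
    (hd : ∀ v, Fintype.card V ≤ G.degree v + d) {v w : V} (hvw : v ≠ w) :
    (Fintype.card V - 2 * d - 3) * (Finset.univ.filter fun f : V → V =>
        IsPartnerMap G f ∧ f v ≠ w ∧ ¬ G.Adj (f v) (f w)).card ≤
      d * (Finset.univ.filter fun f : V → V => IsPartnerMap G f).card := by
  set B := Finset.univ.filter fun f : V → V =>
    IsPartnerMap G f ∧ f v ≠ w ∧ ¬ G.Adj (f v) (f w) with hB
  set S : (V → V) → Finset V := fun f => Finset.univ.filter fun y =>
    (G.Adj w y ∧ G.Adj (f w) (f y)) ∧ y ∉ ({f w, v, f v} : Finset V) with hS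
  set T : (V → V) → Finset V := fun g => Finset.univ.filter fun b => ¬ G.Adj (g v) b with hT
  have hScard : ∀ f ∈ B, Fintype.card V - 2 * d - 3 ≤ (S f).card := by
    intro f hf
    have hf' := (Finset.mem_filter.1 hf).2.1
    have h1 := card_not_switchable hd (fun x => (hf' x).2) w (f w)
    have h2 := Finset.card_le_three (a := f w) (b := v) (c := f v)
    have h3 : (Finset.univ : Finset V) ⊆ S f ∪
        ((Finset.univ.filter fun y => ¬ (G.Adj w y ∧ G.Adj (f w) (f y))) ∪ {f w, v, f v}) := by
      intro y _
      simp only [hS, Finset.mem_union, Finset.mem_filter, Finset.mem_univ, true_and]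
      tauto
    have h4 := Finset.card_le_card h3
    rw [Finset.card_univ] at h4
    have h5 := Finset.card_union_le (S f)
      ((Finset.univ.filter fun y => ¬ (G.Adj w y ∧ G.Adj (f w) (f y))) ∪ {f w, v, f v})
    have h6 := Finset.card_union_le
      (Finset.univ.filter fun y => ¬ (G.Adj w y ∧ G.Adj (f w) (f y))) {f w, v, f v}
    omega
  have hTcard : ∀ g : V → V, (T g).card ≤ d := fun g => card_not_adj hd (g v)
  have hkey : ∀ f ∈ B, ∀ y ∈ S f, IsPartnerMap G (conjSwap (f w) y f) ∧
      conjSwap (f w) y f v = f v ∧ conjSwap (f w) y f w = y := by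
    intro f hf y hy
    simp only [hB, hS, Finset.mem_filter, Finset.mem_univ, true_and, Finset.mem_insert,
      Finset.mem_singleton] at hf hy
    obtain ⟨hf, hfv, -⟩ := hf
    have hinv : ∀ x, f (f x) = x := fun x => (hf x).2
    have hpq : f (f w) ≠ y := by rw [hinv]; exact hy.1.1.ne
    refine ⟨hf.conjSwap hpq hy.1.2 (by rw [hinv]; exact hy.1.1.symm), ?_, ?_⟩
    all_goals
      rw [conjSwap_apply hinv (fun x => (hf x).1.ne') hpq]
      have := hinv v
      have := hinv w
      have := hinv y
      have := (hf w).1.ne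
      grind
  calc (Fintype.card V - 2 * d - 3) * B.card
      = ∑ _f ∈ B, (Fintype.card V - 2 * d - 3) := by simp [mul_comm]
    _ ≤ ∑ f ∈ B, (S f).card := Finset.sum_le_sum hScard
    _ = (B.sigma S).card := (Finset.card_sigma _ _).symm
    _ ≤ ((Finset.univ.filter fun f : V → V => IsPartnerMap G f).sigma T).card := by
      refine Finset.card_le_card_of_injOn
        (fun p => ⟨conjSwap (p.1 w) p.2 p.1, p.1 w⟩) ?_ ?_
      · rintro ⟨f, y⟩ hp
        obtain ⟨hf, hy⟩ := Finset.mem_sigma.1 hp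
        obtain ⟨h1, h2, -⟩ := hkey f hf y hy
        refine Finset.mem_sigma.2 ⟨by simpa using h1, ?_⟩
        simp only [hT, Finset.mem_filter, Finset.mem_univ, true_and, h2]
        exact (Finset.mem_filter.1 hf).2.2.2
      · rintro ⟨f, y⟩ hp ⟨f', y'⟩ hp' heq
        obtain ⟨hf, hy⟩ := Finset.mem_sigma.1 hp
        obtain ⟨hf', hy'⟩ := Finset.mem_sigma.1 hp'
        have h1 := (hkey f hf y hy).2.2
        have h2 := (hkey f' hf' y' hy').2.2
        simp only [Sigma.mk.injEq, heq_eq_eq] at heq h1 h2 ⊢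
        obtain ⟨heq, hb⟩ := heq
        have hyy : y = y' := by rw [← h1, ← h2, heq]
        refine ⟨?_, hyy⟩
        rw [← conjSwap_conjSwap (f w) y f, heq, hb, hyy, conjSwap_conjSwap]
    _ = ∑ g ∈ Finset.univ.filter (fun f : V → V => IsPartnerMap G f), (T g).card :=
      Finset.card_sigma _ _
    _ ≤ ∑ _g ∈ Finset.univ.filter (fun f : V → V => IsPartnerMap G f), d :=
      Finset.sum_le_sum fun g _ => hTcard g
    _ = _ := by simp [mul_comm]

open scoped Classical in
theorem card_partners_adj [Fintype V] [DecidableEq V] {G : SimpleGraph V} [DecidableRel G.Adj]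
    {v w : V} (hvw : G.Adj v w) :
    (Finset.univ.filter fun f : V → V =>
        IsPartnerMap G f ∧ f v ≠ w ∧ G.Adj (f v) (f w)).card ≤
      Fintype.card V *
        (Finset.univ.filter fun f : V → V => IsPartnerMap G f ∧ f v = w).card := by
  rw [mul_comm, ← Finset.card_univ, ← Finset.card_product]
  refine Finset.card_le_card_of_injOn (fun f => (conjSwap (f v) w f, f v)) ?_ ?_
  · intro f hf
    simp only [Finset.coe_filter, Finset.mem_univ, true_and, Set.mem_ofPred_eq] at hf
    obtain ⟨hf, hfv, hadj⟩ := hf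
    have hinv : ∀ x, f (f x) = x := fun x => (hf x).2
    have hpq : f (f v) ≠ w := by rw [hinv]; exact hvw.ne
    simp only [Finset.coe_product, Finset.coe_univ, Set.mem_prod, Set.mem_univ, and_true,
      Finset.coe_filter, Finset.mem_univ, true_and, Set.mem_ofPred_eq]
    refine ⟨hf.conjSwap hpq hadj (by rw [hinv]; exact hvw.symm), ?_⟩
    rw [conjSwap_apply hinv (fun x => (hf x).1.ne') hpq]
    have := hinv v
    have := (hf v).1.ne
    have := hvw.ne
    grind
  · intro f _ f' _ heq
    simp only [Prod.mk.injEq] at heq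
    rw [← conjSwap_conjSwap (f v) w f, heq.1, heq.2, conjSwap_conjSwap]

open scoped Classical in
/-- Every edge `{v, w}` lies in at least a `99/(100n)` fraction of the perfect matchings. -/
theorem card_isPartnerMap_le [Fintype V] [DecidableEq V] {G : SimpleGraph V} [DecidableRel G.Adj]
    {d : ℕ}
    (hd : ∀ v, Fintype.card V ≤ G.degree v + d) (hV : 16000000 * d ^ 2 ≤ Fintype.card V)
    {v w : V} (hvw : G.Adj v w) :
    99 * (Finset.univ.filter fun f : V → V => IsPartnerMap G f).card ≤
      100 * (Fintype.card V *
        (Finset.univ.filter fun f : V → V => IsPartnerMap G f ∧ f v = w).card) := by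
  have hB := card_partners_not_adj hd hvw.ne
  have hC := card_partners_adj hvw
  have hN : (Finset.univ.filter fun f : V → V => IsPartnerMap G f).card ≤
      (Finset.univ.filter fun f : V → V => IsPartnerMap G f ∧ f v = w).card +
      ((Finset.univ.filter fun f : V → V =>
        IsPartnerMap G f ∧ f v ≠ w ∧ ¬ G.Adj (f v) (f w)).card +
      (Finset.univ.filter fun f : V → V =>
        IsPartnerMap G f ∧ f v ≠ w ∧ G.Adj (f v) (f w)).card) := by
    refine (Finset.card_le_card (t := _ ∪ (_ ∪ _)) fun f hf => ?_).trans
      ((Finset.card_union_le _ _).trans (Nat.add_le_add_left (Finset.card_union_le _ _) _))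
    simp only [Finset.mem_union, Finset.mem_filter, Finset.mem_univ, true_and] at hf ⊢
    tauto
  have hd1 : 1 ≤ d := by
    have := hd v
    have := G.degree_lt_card_verts v
    omega
  generalize (Finset.univ.filter fun f : V → V =>
    IsPartnerMap G f ∧ f v ≠ w ∧ ¬ G.Adj (f v) (f w)).card = b at *
  generalize (Finset.univ.filter fun f : V → V =>
    IsPartnerMap G f ∧ f v ≠ w ∧ G.Adj (f v) (f w)).card = c at *
  generalize (Finset.univ.filter fun f : V → V => IsPartnerMap G f ∧ f v = w).card = a at *
  generalize (Finset.univ.filter fun f : V → V => IsPartnerMap G f).card = N at *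
  have hdd : d ≤ d ^ 2 := Nat.le_self_pow two_ne_zero d
  have h1 : 1000 * b ≤ N := by
    refine Nat.le_of_mul_le_mul_left (c := d) (le_trans ?_ hB) hd1
    rw [← mul_assoc]
    exact Nat.mul_le_mul_right b (by omega)
  have h2 : 1000 * a ≤ Fintype.card V * a := Nat.mul_le_mul_right a (by omega)
  omega

theorem natCard_perfectMatching (G : SimpleGraph V) (Q : G.Subgraph → Prop) (R : (V → V) → Prop)
    (hQR : ∀ (M : G.Subgraph) (f : V → V), (∀ x y, M.Adj x y ↔ f x = y) → (Q M ↔ R f)) :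
    Nat.card {M : G.Subgraph // M.IsPerfectMatching ∧ Q M} =
      Nat.card {f : V → V // IsPartnerMap G f ∧ R f} := by
  have hex : ∀ M : {M : G.Subgraph // M.IsPerfectMatching ∧ Q M},
      ∃ f : V → V, ∀ x y, M.1.Adj x y ↔ f x = y := by
    rintro ⟨M, hM, -⟩
    choose f hf hf' using SimpleGraph.Subgraph.isPerfectMatching_iff.1 hM
    exact ⟨f, fun x y => ⟨fun h => (hf' x y h).symm, fun h => h ▸ hf x⟩⟩
  choose F hF using hex
  refine Nat.card_congr (Equiv.ofBijective (fun M => ⟨F M, fun x => ⟨?_, ?_⟩, ?_⟩) ⟨?_, ?_⟩)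
  · exact M.1.adj_sub ((hF M x _).2 rfl)
  · exact (hF M _ _).1 (M.1.adj_symm ((hF M x _).2 rfl))
  · exact (hQR M.1 (F M) (hF M)).1 M.2.2
  · intro M M' h
    have h' : F M = F M' := congrArg Subtype.val h
    refine Subtype.ext (SimpleGraph.Subgraph.ext ?_ ?_)
    · rw [SimpleGraph.Subgraph.isSpanning_iff.1 M.2.1.2,
        SimpleGraph.Subgraph.isSpanning_iff.1 M'.2.1.2]
    · ext x y
      rw [hF, hF, h']
  · rintro ⟨f, hf, hR⟩
    let M : G.Subgraph :=
      { verts := Set.univ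
        Adj := fun x y => f x = y
        adj_sub := by rintro x y rfl; exact (hf x).1
        edge_vert := fun _ => Set.mem_univ _
        symm := ⟨by rintro x y rfl; exact (hf x).2⟩ }
    have hM : M.IsPerfectMatching :=
      SimpleGraph.Subgraph.isPerfectMatching_iff.2 fun x => ⟨f x, rfl, fun y h => Eq.symm h⟩
    have hQ : Q M := (hQR M f fun _ _ => Iff.rfl).2 hR
    refine ⟨⟨M, hM, hQ⟩, Subtype.ext (funext fun x => ?_)⟩
    exact (hF ⟨M, hM, hQ⟩ x (f x)).1 rfl

end


/-- **Near-uniform marginals of a random perfect matching in a very dense graph.**  Let `G`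
be a graph on an even number `n ≥ 4` of vertices in which every vertex has at least
`n - √n/4000` neighbors.  For vertices `u, v`, let `P_v(u)` be the probability that the edge
`(u,v)` belongs to a uniformly random perfect matching of `G`, expressed as the ratio of the
number of perfect matchings containing `s(u,v)` to the total number of perfect matchings.
Then for every vertex `v`, the number of vertices `u` with `P_v(u) < 99/(100n)` is at most
`√n/9`. -/
theorem random_matching_marginal_mostly_uniform (n : ℕ) (hn : 4 ≤ n) (heven : Even n)
    (V : Type) [Fintype V] [DecidableEq V] (hcard : Fintype.card V = n)
    (G : SimpleGraph V) [DecidableRel G.Adj]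
    (hdeg : ∀ v : V, (n : ℝ) - Real.sqrt n / 4000 ≤ (G.degree v : ℝ)) :
    ∀ v : V,
      (Nat.card {u : V //
          (Nat.card {M : G.Subgraph // M.IsPerfectMatching ∧ s(u, v) ∈ M.edgeSet} : ℝ) /
            (Nat.card {M : G.Subgraph // M.IsPerfectMatching} : ℝ) <
          99 / (100 * n)} : ℝ) ≤
        Real.sqrt n / 9 := by
  classical
  intro v
  have hsqrt : 0 ≤ Real.sqrt n / 4000 := by positivity
  obtain ⟨d, hd_def⟩ : ∃ d : ℕ, d = ⌊Real.sqrt n / 4000⌋₊ := ⟨_, rfl⟩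
  have hd_le : (d : ℝ) ≤ Real.sqrt n / 4000 := hd_def ▸ Nat.floor_le hsqrt
  have hd : ∀ x, Fintype.card V ≤ G.degree x + d := by
    intro x
    have h1 : n - G.degree x ≤ d := by
      rw [hd_def]
      refine Nat.le_floor ?_
      rw [Nat.cast_sub (hcard ▸ (G.degree_lt_card_verts x).le)]
      linarith [hdeg x]
    omega
  have hV : 16000000 * d ^ 2 ≤ Fintype.card V := by
    have h1 : (4000 * (d : ℝ)) ^ 2 ≤ n := by
      rw [← Real.sq_sqrt (Nat.cast_nonneg n)]
      exact pow_le_pow_left₀ (by positivity) (by linarith) 2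
    have h2 : (16000000 * d ^ 2 : ℝ) ≤ n := by linarith
    rw [hcard]
    exact_mod_cast h2
  have hd2 : d ≤ d ^ 2 := Nat.le_self_pow two_ne_zero d
  obtain ⟨f₀, hf₀⟩ := exists_isPartnerMap hd (by omega) (hcard ▸ heven)
  have hN : Nat.card {M : G.Subgraph // M.IsPerfectMatching} =
      (Finset.univ.filter fun f : V → V => IsPartnerMap G f).card := by
    have := natCard_perfectMatching G (fun _ => True) (fun _ => True) (by simp)
    simpa [Nat.card_eq_fintype_card, Fintype.card_subtype] using this
  have hNpos : 0 < (Finset.univ.filter fun f : V → V => IsPartnerMap G f).card :=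
    Finset.card_pos.2 ⟨f₀, by simpa using hf₀⟩
  have hA : ∀ u, Nat.card {M : G.Subgraph // M.IsPerfectMatching ∧ s(u, v) ∈ M.edgeSet} =
      (Finset.univ.filter fun f : V → V => IsPartnerMap G f ∧ f v = u).card := by
    intro u
    rw [natCard_perfectMatching G (fun M => s(u, v) ∈ M.edgeSet) (fun f => f v = u),
      Nat.card_eq_fintype_card, Fintype.card_subtype]
    intro M f h
    rw [SimpleGraph.Subgraph.mem_edgeSet, M.adj_comm, h]
  rw [Nat.card_eq_fintype_card, Fintype.card_subtype]
  refine le_trans (Nat.cast_le.2 ((Finset.card_le_card fun u hu => ?_).trans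
    (card_not_adj hd v))) (by linarith)
  simp only [Finset.mem_filter, Finset.mem_univ, true_and] at hu ⊢
  intro hvu
  have hle := card_isPartnerMap_le hd hV hvu
  rw [hA, hN, div_lt_div_iff₀ (by exact_mod_cast hNpos) (by positivity)] at hu
  rw [hcard] at hle
  have hle' := (Nat.cast_le (α := ℝ)).2 hle
  push_cast at hle'
  linarith
end

section
/- Let ε ∈ [0,1), let Δ ≥ 4 be an integer, let G be a simple graph with maximum degree Δ, and let v be a vertex of G with degree exactly Δ such that the number of unordered pairs {u, u'} of distinct vertices of N(v) with u and u' non-adjacent in G is at least ε²·(Δ choose 2). Assign to each vertex w of G a color x(w) chosen independently and uniformly at random from {1, …, Δ+1}. Call a non-adjacent pair {u, u'} ⊆ N(v) good iff x(u) = x(u') and no vertex w ∈ N(u) ∪ N(u') has x(w) = x(u). Then the expected number of good pairs is at least e^{−5}·ε²·Δ. -/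
/-- Colorings giving `u` and `u'` the color `c` and avoiding `c` on `S`. -/
theorem card_colorings_eq_and_avoid {V : Type} [Fintype V] [DecidableEq V] (n : ℕ)
    {u u' : V} (huu' : u ≠ u') (S : Finset V) (hu : u ∉ S) (hu' : u' ∉ S) (c : Fin (n + 1)) :
    ((Finset.univ.filter fun x : V → Fin (n + 1) =>
        x u = c ∧ x u' = c ∧ ∀ w ∈ S, x w ≠ c).card : ℝ) =
      (n + 1 : ℝ) ^ Fintype.card V *
        ((1 / (n + 1 : ℝ)) * (1 / (n + 1 : ℝ)) * ((n : ℝ) / (n + 1)) ^ S.card) := by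
  have hset : (Finset.univ.filter fun x : V → Fin (n + 1) =>
        x u = c ∧ x u' = c ∧ ∀ w ∈ S, x w ≠ c) =
      Fintype.piFinset fun w =>
        if w = u ∨ w = u' then {c} else if w ∈ S then {c}ᶜ else Finset.univ := by
    ext x
    simp only [Finset.mem_filter, Finset.mem_univ, true_and, Fintype.mem_piFinset]
    constructor
    · rintro ⟨h1, h2, h3⟩ w
      split_ifs with h h'
      · rcases h with rfl | rfl <;> simpa
      · simpa using h3 w h'
      · simp
    · intro h
      refine ⟨by simpa using h u, by simpa using h u', fun w hw => ?_⟩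
      have hwu : ¬ (w = u ∨ w = u') := by
        rintro (rfl | rfl) <;> contradiction
      simpa [hwu, hw] using h w
  have hn : (n + 1 : ℝ) ≠ 0 := by positivity
  have hfac : ∀ w : V, (((if w = u ∨ w = u' then {c} else
        if w ∈ S then {c}ᶜ else Finset.univ : Finset (Fin (n + 1))).card : ℕ) : ℝ) =
      (n + 1 : ℝ) * ((if w = u then 1 / (n + 1 : ℝ) else 1) *
        (if w = u' then 1 / (n + 1 : ℝ) else 1) * (if w ∈ S then (n : ℝ) / (n + 1) else 1)) := by
    intro w
    by_cases h1 : w = u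
    · subst h1
      simp [huu', hu, hn]
    by_cases h2 : w = u'
    · subst h2
      simp [h1, hu', hn]
    by_cases h3 : w ∈ S
    · simp [h1, h2, h3, Finset.card_compl]
      field_simp
    · simp [h1, h2, h3]
  rw [hset, Fintype.card_piFinset, Nat.cast_prod, Finset.prod_congr rfl fun w _ => hfac w,
    Finset.prod_mul_distrib, Finset.prod_mul_distrib, Finset.prod_mul_distrib,
    Finset.prod_ite_eq', Finset.prod_ite_eq', Finset.prod_ite_mem]
  simp [div_pow]

theorem card_colorings_monochromatic_and_avoid {V : Type} [Fintype V] [DecidableEq V] (n : ℕ)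
    {u u' : V} (huu' : u ≠ u') (S : Finset V) (hu : u ∉ S) (hu' : u' ∉ S) :
    ((Finset.univ.filter fun x : V → Fin (n + 1) =>
        x u = x u' ∧ ∀ w ∈ S, x w ≠ x u).card : ℝ) =
      (n + 1 : ℝ) ^ Fintype.card V * ((1 / (n + 1 : ℝ)) * ((n : ℝ) / (n + 1)) ^ S.card) := by
  have hn : (n + 1 : ℝ) ≠ 0 := by positivity
  rw [Finset.card_eq_sum_card_fiberwise (f := fun x => x u) (t := Finset.univ)
    (fun _ _ => Finset.mem_coe.2 (Finset.mem_univ _)), Nat.cast_sum]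
  have hfib : ∀ c : Fin (n + 1), ((Finset.univ.filter fun x : V → Fin (n + 1) =>
      x u = x u' ∧ ∀ w ∈ S, x w ≠ x u).filter fun x => x u = c) =
      Finset.univ.filter fun x => x u = c ∧ x u' = c ∧ ∀ w ∈ S, x w ≠ c := by
    intro c
    ext x
    simp only [Finset.mem_filter, Finset.mem_univ, true_and]
    constructor
    · rintro ⟨⟨h1, h2⟩, rfl⟩
      exact ⟨rfl, h1.symm, h2⟩
    · rintro ⟨rfl, h1, h2⟩
      exact ⟨⟨h1.symm, h2⟩, rfl⟩
  simp_rw [hfib, card_colorings_eq_and_avoid n huu' S hu hu']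
  simp only [Finset.sum_const, Finset.card_univ, Fintype.card_fin, nsmul_eq_mul]
  push_cast
  field_simp

theorem exp_neg_two_le_div_add_one_pow {n : ℕ} (hn : 0 < n) :
    Real.exp (-2) ≤ ((n : ℝ) / (n + 1)) ^ (2 * n) := by
  have hn' : (0 : ℝ) < n := by exact_mod_cast hn
  have h : Real.exp (-(1 / n)) ≤ (n : ℝ) / (n + 1) := by
    rw [Real.exp_neg, inv_le_comm₀ (Real.exp_pos _) (by positivity), inv_div]
    have := Real.add_one_le_exp (1 / (n : ℝ))
    calc ((n : ℝ) + 1) / n = 1 / n + 1 := by field_simp; ring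
      _ ≤ _ := this
  calc Real.exp (-2) = Real.exp (-(1 / n)) ^ (2 * n) := by
        rw [← Real.exp_nat_mul]
        congr 1
        push_cast
        field_simp
    _ ≤ _ := pow_le_pow_left₀ (Real.exp_pos _).le h _

theorem exp_neg_five_mul_le_choose_two_mul {n : ℕ} (hn : 4 ≤ n) :
    Real.exp (-5) * n ≤ (n.choose 2 : ℝ) * ((1 / (n + 1 : ℝ)) * Real.exp (-2)) := by
  have hn' : (4 : ℝ) ≤ n := by exact_mod_cast hn
  have h3 : Real.exp (-3) ≤ 1 / 4 := by
    rw [Real.exp_neg, inv_le_comm₀ (Real.exp_pos _) (by norm_num)]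
    have := Real.add_one_le_exp (3 : ℝ)
    linarith
  have hsplit : Real.exp (-5) = Real.exp (-3) * Real.exp (-2) := by
    rw [← Real.exp_add]; norm_num
  have hfrac : (n : ℝ) / 4 ≤ n.choose 2 * (1 / (n + 1)) := by
    rw [Nat.cast_choose_two, mul_one_div, le_div_iff₀ (by positivity)]
    nlinarith
  rw [hsplit]
  calc Real.exp (-3) * Real.exp (-2) * n ≤ (1 / 4) * Real.exp (-2) * n := by gcongr
    _ = (n : ℝ) / 4 * Real.exp (-2) := by ring
    _ ≤ n.choose 2 * (1 / (n + 1)) * Real.exp (-2) := by gcongr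
    _ = _ := by ring

/-- A lower bound on the number of colorings for which a given non-adjacent pair is good. -/
theorem le_card_colorings_good_pair {V : Type} [Fintype V] [DecidableEq V]
    (G : SimpleGraph V) [DecidableRel G.Adj] (hΔ : 0 < G.maxDegree)
    {u u' : V} (huu' : u ≠ u') (hadj : ¬ G.Adj u u') :
    (G.maxDegree + 1 : ℝ) ^ Fintype.card V *
        ((1 / (G.maxDegree + 1 : ℝ)) * Real.exp (-2)) ≤
      ((Finset.univ.filter fun x : V → Fin (G.maxDegree + 1) =>
        x u = x u' ∧ ∀ w, G.Adj u w ∨ G.Adj u' w → x w ≠ x u).card : ℝ) := by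
  have hcard := card_colorings_monochromatic_and_avoid G.maxDegree huu'
    (G.neighborFinset u ∪ G.neighborFinset u')
    (by simpa [G.adj_comm u'] using hadj) (by simpa using hadj)
  simp only [Finset.mem_union, SimpleGraph.mem_neighborFinset] at hcard
  rw [hcard]
  have hS : (G.neighborFinset u ∪ G.neighborFinset u').card ≤ 2 * G.maxDegree := by
    have h1 := Finset.card_union_le (G.neighborFinset u) (G.neighborFinset u')
    have h2 := G.degree_le_maxDegree u
    have h3 := G.degree_le_maxDegree u'
    simp only [SimpleGraph.card_neighborFinset_eq_degree] at h1
    omega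
  gcongr
  exact (exp_neg_two_le_div_add_one_pow hΔ).trans
    (pow_le_pow_of_le_one (by positivity) (by rw [div_le_one (by positivity)]; linarith) hS)


/-- **Expected number of good pairs in the one-shot coloring step.**  Let `G` have maximum
degree `Δ ≥ 4`, let `v` be a vertex of degree exactly `Δ` such that at least `ε²·(Δ choose 2)`
unordered pairs of distinct vertices of `N(v)` are non-adjacent in `G`.  Color every vertex
`w` with a color `x w` chosen independently and uniformly at random from `{1, …, Δ+1}`
(modeled by the uniform sample space `V → Fin (Δ+1)`).  A non-adjacent pair
`{u, u'} ⊆ N(v)` is good iff `x u = x u'` and no vertex `w ∈ N(u) ∪ N(u')` has `x w = x u`.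
Then the expected number of good pairs is at least `e⁻⁵ · ε² · Δ`. -/
theorem expected_good_pairs {V : Type} [Fintype V] [DecidableEq V]
    (G : SimpleGraph V) [DecidableRel G.Adj] (ε : ℝ) (hε0 : 0 ≤ ε) (hε1 : ε < 1)
    (hΔ : 4 ≤ G.maxDegree) (v : V) (hdeg : G.degree v = G.maxDegree)
    (hpairs : ε ^ 2 * (G.maxDegree.choose 2 : ℝ) ≤
      (Nat.card {p : Sym2 V // ¬ p.IsDiag ∧ (∀ y ∈ p, G.Adj v y) ∧ p ∉ G.edgeSet} : ℝ)) :
    Real.exp (-5) * ε ^ 2 * (G.maxDegree : ℝ) ≤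
      (∑ x : V → Fin (G.maxDegree + 1),
          (Nat.card {p : Sym2 V //
              (¬ p.IsDiag ∧ (∀ y ∈ p, G.Adj v y) ∧ p ∉ G.edgeSet) ∧
              ∃ u u' : V, p = s(u, u') ∧ x u = x u' ∧
                ∀ w : V, G.Adj u w ∨ G.Adj u' w → x w ≠ x u} : ℝ)) /
        (Nat.card (V → Fin (G.maxDegree + 1)) : ℝ) := by
  classical
  have hpos : (0 : ℝ) < (G.maxDegree + 1 : ℝ) ^ Fintype.card V := by positivity
  have hV : (Nat.card (V → Fin (G.maxDegree + 1)) : ℝ) =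
      (G.maxDegree + 1 : ℝ) ^ Fintype.card V := by
    simp
  rw [hV, le_div_iff₀ hpos]
  set A : Finset (Sym2 V) :=
    Finset.univ.filter fun p => ¬ p.IsDiag ∧ (∀ y ∈ p, G.Adj v y) ∧ p ∉ G.edgeSet with hA
  have hcardA : Nat.card {p : Sym2 V // ¬ p.IsDiag ∧ (∀ y ∈ p, G.Adj v y) ∧ p ∉ G.edgeSet} =
      A.card := by
    rw [Nat.card_eq_fintype_card, Fintype.card_subtype]
  rw [hcardA] at hpairs
  let good (x : V → Fin (G.maxDegree + 1)) (p : Sym2 V) : Prop :=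
    ∃ u u' : V, p = s(u, u') ∧ x u = x u' ∧ ∀ w : V, G.Adj u w ∨ G.Adj u' w → x w ≠ x u
  have hswap : (∑ x : V → Fin (G.maxDegree + 1),
      (Nat.card {p : Sym2 V // (¬ p.IsDiag ∧ (∀ y ∈ p, G.Adj v y) ∧ p ∉ G.edgeSet) ∧
        good x p} : ℝ)) =
      ∑ p ∈ A, ((Finset.univ.filter fun x => good x p).card : ℝ) := by
    have h := Finset.sum_card_bipartiteAbove_eq_sum_card_bipartiteBelow
      (s := (Finset.univ : Finset (V → Fin (G.maxDegree + 1)))) (t := A) good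
    have hx : ∀ x, Nat.card {p : Sym2 V //
        (¬ p.IsDiag ∧ (∀ y ∈ p, G.Adj v y) ∧ p ∉ G.edgeSet) ∧ good x p} =
        (A.bipartiteAbove good x).card := by
      intro x
      rw [Nat.card_eq_fintype_card, Fintype.card_subtype, Finset.bipartiteAbove, hA,
        Finset.filter_filter]
    simp_rw [hx]
    exact_mod_cast h
  have hgood : ∀ p ∈ A, (G.maxDegree + 1 : ℝ) ^ Fintype.card V *
      ((1 / (G.maxDegree + 1 : ℝ)) * Real.exp (-2)) ≤
      ((Finset.univ.filter fun x => good x p).card : ℝ) := by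
    intro p hp
    induction p using Sym2.ind with | _ u u' => ?_
    simp only [hA, Finset.mem_filter, Finset.mem_univ, true_and, Sym2.mk_isDiag_iff,
      SimpleGraph.mem_edgeSet] at hp
    refine (le_card_colorings_good_pair G (by omega) hp.1 hp.2.2).trans ?_
    gcongr with x
    exact fun h => ⟨u, u', rfl, h⟩
  refine le_trans ?_ (hswap.symm ▸ Finset.card_nsmul_le_sum A _ _ hgood)
  rw [nsmul_eq_mul]
  set N : ℝ := (G.maxDegree + 1 : ℝ) ^ Fintype.card V
  set q : ℝ := (1 / (G.maxDegree + 1 : ℝ)) * Real.exp (-2)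
  have hq : 0 ≤ q := by positivity
  calc Real.exp (-5) * ε ^ 2 * G.maxDegree * N
      = ε ^ 2 * (Real.exp (-5) * G.maxDegree) * N := by ring
    _ ≤ ε ^ 2 * (G.maxDegree.choose 2 * q) * N := by
        gcongr ε ^ 2 * ?_ * N
        exact exp_neg_five_mul_le_choose_two_mul hΔ
    _ = ε ^ 2 * G.maxDegree.choose 2 * (N * q) := by ring
    _ ≤ A.card * (N * q) := by gcongr
end

section
/- Let ε ∈ [0, 1/2), let G be a simple graph with maximum degree Δ, let v be an ε-dense vertex of G, and let S_v be the set of neighbors u of v such that (u,v) is an ε-friend edge (so |S_v| ≥ (1−ε)Δ). Then: (i) any two vertices u, w ∈ S_v have at least (1−2ε)Δ common neighbors in G; (ii) every vertex u ∈ S_v has at least (1−2ε)Δ neighbors inside S_v; and (iii) every vertex of S_v is (2ε)-dense. Consequently, v and all of S_v lie in the same connected component of the graph whose vertices are the (2ε)-dense vertices and whose edges are the (2ε)-friend edges, and that component has at least (1−ε)Δ vertices. -/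
/-- `(u,v)` is an `ε`-friend edge of `G`: it is an edge and its endpoints have at least
`(1-ε)Δ` common neighbors, where `Δ` is the maximum degree of `G`. -/
def EpsFriend {V : Type} [Fintype V] [DecidableEq V] (G : SimpleGraph V)
    [DecidableRel G.Adj] (ε : ℝ) (u v : V) : Prop :=
  G.Adj u v ∧
    (1 - ε) * (G.maxDegree : ℝ) ≤ ((G.neighborFinset u ∩ G.neighborFinset v).card : ℝ)

/-- `v` is `ε`-dense in `G`: at least `(1-ε)Δ` of the edges of `G` incident to `v` are
`ε`-friend edges.  A vertex is `ε`-sparse iff it is not `ε`-dense. -/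
def EpsDense {V : Type} [Fintype V] [DecidableEq V] (G : SimpleGraph V)
    [DecidableRel G.Adj] (ε : ℝ) (v : V) : Prop :=
  (1 - ε) * (G.maxDegree : ℝ) ≤ (Nat.card {u : V // EpsFriend G ε u v} : ℝ)

/-- The graph whose vertices are the `ε`-dense vertices of `G` and whose edges are the
`ε`-friend edges of `G` (realized as a graph on the vertex set of `G`, where all other
vertices are isolated). -/
def denseFriendGraph {V : Type} [Fintype V] [DecidableEq V] (G : SimpleGraph V)
    [DecidableRel G.Adj] (ε : ℝ) : SimpleGraph V :=
  SimpleGraph.fromRel (fun a b => EpsFriend G ε a b ∧ EpsDense G ε a ∧ EpsDense G ε b)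

/-- Two subsets of a finite set of size at most `d`, each of size at least `(1-ε)d`, meet in at
least `(1-2ε)d` elements. -/
theorem one_sub_two_mul_le_card_inter {α : Type*} [DecidableEq α] {s t w : Finset α} {ε : ℝ}
    {d : ℕ} (hsw : s ⊆ w) (htw : t ⊆ w) (hw : w.card ≤ d)
    (hs : (1 - ε) * (d : ℝ) ≤ (s.card : ℝ)) (ht : (1 - ε) * (d : ℝ) ≤ (t.card : ℝ)) :
    (1 - 2 * ε) * (d : ℝ) ≤ ((s ∩ t).card : ℝ) := by
  have hunion : (s ∪ t).card ≤ d := (Finset.card_le_card (Finset.union_subset hsw htw)).trans hw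
  have hsum : s.card + t.card ≤ (s ∩ t).card + d := by
    have := Finset.card_union_add_card_inter s t
    omega
  have hsum' : (s.card : ℝ) + t.card ≤ (s ∩ t).card + d := by exact_mod_cast hsum
  linarith

section

variable {V : Type} [Fintype V] [DecidableEq V] {G : SimpleGraph V} [DecidableRel G.Adj]
  {ε δ : ℝ} {u v w : V}

theorem EpsFriend.mono (hεδ : ε ≤ δ) (h : EpsFriend G ε u v) : EpsFriend G δ u v :=
  ⟨h.1, le_trans (by gcongr) h.2⟩

theorem EpsDense.mono (hεδ : ε ≤ δ) (h : EpsDense G ε v) : EpsDense G δ v := by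
  have hcard : Nat.card {u : V // EpsFriend G ε u v} ≤ Nat.card {u : V // EpsFriend G δ u v} :=
    Nat.card_le_card_of_injective _
      (Subtype.map_injective (fun _ hu => hu.mono hεδ) Function.injective_id)
  calc (1 - δ) * (G.maxDegree : ℝ) ≤ (1 - ε) * (G.maxDegree : ℝ) := by gcongr
    _ ≤ (Nat.card {u : V // EpsFriend G ε u v} : ℝ) := h
    _ ≤ (Nat.card {u : V // EpsFriend G δ u v} : ℝ) := by exact_mod_cast hcard

/-- Two `ε`-friends of a common vertex have at least `(1-2ε)Δ` common neighbors. -/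
theorem EpsFriend.le_card_inter_neighborFinset (hu : EpsFriend G ε u v)
    (hw : EpsFriend G ε w v) :
    (1 - 2 * ε) * (G.maxDegree : ℝ) ≤
      ((G.neighborFinset u ∩ G.neighborFinset w).card : ℝ) := by
  refine (one_sub_two_mul_le_card_inter Finset.inter_subset_right Finset.inter_subset_right
    (G.degree_le_maxDegree v) hu.2 hw.2).trans ?_
  gcongr <;> exact Finset.inter_subset_left

/-- An `ε`-friend of an `ε`-dense vertex `v` is adjacent to at least `(1-2ε)Δ` of the
`ε`-friends of `v`. -/
theorem EpsDense.le_card_friend_adj (hv : EpsDense G ε v) (hu : EpsFriend G ε u v) :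
    (1 - 2 * ε) * (G.maxDegree : ℝ) ≤
      (Nat.card {z : V // EpsFriend G ε z v ∧ G.Adj u z} : ℝ) := by
  classical
  have hfriends : (1 - ε) * (G.maxDegree : ℝ) ≤
      ((Finset.univ.filter fun z => EpsFriend G ε z v).card : ℝ) := by
    simpa only [EpsDense, Nat.card_eq_fintype_card, Fintype.card_subtype] using hv
  rw [Nat.card_eq_fintype_card, Fintype.card_subtype]
  refine (one_sub_two_mul_le_card_inter (w := G.neighborFinset v) ?_
    Finset.inter_subset_right (G.degree_le_maxDegree v) hfriends hu.2).trans ?_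
  · intro z hz
    simpa using (Finset.mem_filter.1 hz).2.1.symm
  · refine Nat.cast_le.2 (Finset.card_le_card fun z hz => ?_)
    simp only [Finset.mem_inter, Finset.mem_filter, Finset.mem_univ, true_and,
      SimpleGraph.mem_neighborFinset] at hz ⊢
    exact ⟨hz.1, hz.2.1⟩

/-- Every `ε`-friend of an `ε`-dense vertex is `(2ε)`-dense. -/
theorem EpsDense.of_friend (hv : EpsDense G ε v) (hu : EpsFriend G ε u v) :
    EpsDense G (2 * ε) u := by
  have hcard : Nat.card {z : V // EpsFriend G ε z v ∧ G.Adj u z} ≤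
      Nat.card {z : V // EpsFriend G (2 * ε) z u} :=
    Nat.card_le_card_of_injective _ (Subtype.map_injective
      (fun _ hz => ⟨hz.2.symm, hz.1.le_card_inter_neighborFinset hu⟩) Function.injective_id)
  exact (hv.le_card_friend_adj hu).trans (by exact_mod_cast hcard)

theorem EpsFriend.denseFriendGraph_adj (huv : EpsFriend G ε u v) (hu : EpsDense G ε u)
    (hv : EpsDense G ε v) : (denseFriendGraph G ε).Adj u v :=
  (SimpleGraph.fromRel_adj _ _ _).2 ⟨huv.1.ne, Or.inl ⟨huv, hu, hv⟩⟩

end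

/-- Let `ε ∈ [0, 1/2)`, let `v` be an `ε`-dense vertex of `G` and let
`S_v = {u : (u,v) is an ε-friend edge}` (so `|S_v| ≥ (1-ε)Δ`).  Then (i) any two vertices of
`S_v` have at least `(1-2ε)Δ` common neighbors; (ii) every vertex of `S_v` has at least
`(1-2ε)Δ` neighbors inside `S_v`; (iii) every vertex of `S_v` is `(2ε)`-dense (and so is `v`).
Consequently `v` and all of `S_v` lie in the same connected component of the graph of
`(2ε)`-dense vertices and `(2ε)`-friend edges, and that component has at least `(1-ε)Δ`
vertices. -/
theorem dense_vertex_almost_clique {V : Type} [Fintype V] [DecidableEq V]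
    (G : SimpleGraph V) [DecidableRel G.Adj] (ε : ℝ) (hε0 : 0 ≤ ε) (hε1 : ε < 1 / 2)
    (v : V) (hv : EpsDense G ε v) :
    (1 - ε) * (G.maxDegree : ℝ) ≤ (Nat.card {u : V // EpsFriend G ε u v} : ℝ) ∧
    (∀ u u' : V, EpsFriend G ε u v → EpsFriend G ε u' v →
      (1 - 2 * ε) * (G.maxDegree : ℝ) ≤
        (Nat.card {z : V // G.Adj u z ∧ G.Adj u' z} : ℝ)) ∧
    (∀ u : V, EpsFriend G ε u v →
      (1 - 2 * ε) * (G.maxDegree : ℝ) ≤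
        (Nat.card {z : V // EpsFriend G ε z v ∧ G.Adj u z} : ℝ)) ∧
    (∀ u : V, EpsFriend G ε u v → EpsDense G (2 * ε) u) ∧
    EpsDense G (2 * ε) v ∧
    (∀ u : V, EpsFriend G ε u v →
      (denseFriendGraph G (2 * ε)).connectedComponentMk u =
        (denseFriendGraph G (2 * ε)).connectedComponentMk v) ∧
    (1 - ε) * (G.maxDegree : ℝ) ≤
      (Nat.card ((denseFriendGraph G (2 * ε)).connectedComponentMk v).supp : ℝ) := by
  have hle : ε ≤ 2 * ε := by linarith
  have hcomp : ∀ u : V, EpsFriend G ε u v →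
      (denseFriendGraph G (2 * ε)).connectedComponentMk u =
        (denseFriendGraph G (2 * ε)).connectedComponentMk v := fun u hu =>
    SimpleGraph.ConnectedComponent.sound
      ((hu.mono hle).denseFriendGraph_adj (hv.of_friend hu) (hv.mono hle)).reachable
  refine ⟨hv, fun u w hu hw => ?_, fun u hu => hv.le_card_friend_adj hu,
    fun u hu => hv.of_friend hu, hv.mono hle, hcomp, ?_⟩
  · rw [Nat.card_eq_fintype_card, Fintype.card_subtype]
    refine (hu.le_card_inter_neighborFinset hw).trans
      (Nat.cast_le.2 (Finset.card_le_card fun z hz => ?_))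
    simpa using hz
  · have hcard : Nat.card {u : V // EpsFriend G ε u v} ≤
        Nat.card ((denseFriendGraph G (2 * ε)).connectedComponentMk v).supp :=
      Nat.card_le_card_of_injective _
        (Subtype.map_injective (fun u hu => hcomp u hu) Function.injective_id)
    exact le_trans hv (by exact_mod_cast hcard)
end

section
/- Let n ≥ 1, let x ∈ {0,1}^{n×n}, and let i*, j* ∈ [n] with x_{i*,j*} = 0. Define the graph G on the 4n vertices A₁ ∪ B₁ ∪ A₂ ∪ B₂, where A_t = {a^t_1, …, a^t_n} and B_t = {b^t_1, …, b^t_n} for t ∈ {1,2}, with the following edges: (a^t_i, b^t_j) for t ∈ {1,2} whenever x_{i,j} = 1; the edges (a^1_i, a^1_j), (a^2_i, a^2_j) for all distinct i, j both different from i*, and (a^1_i, a^2_j) for all i, j both different from i*; the edges (b^1_i, b^1_j), (b^2_i, b^2_j) for all distinct i, j both different from j*, and (b^1_i, b^2_j) for all i, j both different from j*; and the edges (a^1_i, b^2_j), (a^2_i, b^1_j) for all i ≠ i* and j ≠ j*. Then every maximal independent set of G contains either both vertices a^1_{i*} and b^1_{j*}, or both vertices a^2_{i*} and b^2_{j*}.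 -/
/-- A maximal independent set is dominating. -/
theorem exists_adj_of_notMem_of_maximal_indep {V : Type*} {G : SimpleGraph V} {S : Set V}
    (hindep : ∀ u ∈ S, ∀ v ∈ S, ¬ G.Adj u v)
    (hmax : ∀ T : Set V, S ⊆ T → (∀ u ∈ T, ∀ v ∈ T, ¬ G.Adj u v) → T = S)
    {v : V} (hv : v ∉ S) : ∃ u ∈ S, G.Adj v u := by
  by_contra! h
  refine hv (hmax (insert v S) (Set.subset_insert v S) ?_ ▸ Set.mem_insert v S)
  rintro a (rfl | ha) b (rfl | hb)
  · exact G.irrefl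
  · exact h b hb
  · exact fun hab => h a ha hab.symm
  · exact hindep a ha b hb


/-- **The hard instance for streaming maximal independent set.**  Vertices are triples
`(t, side, i) : Bool × Bool × Fin n`, where `t` selects the copy (`false` for copy `1`,
`true` for copy `2`), `side = false` denotes the `A`-side (`a^t_i`) and `side = true` the
`B`-side (`b^t_i`).  Given `x : Fin n → Fin n → Bool` and indices `i*, j*`, the edges are:
`(a^t_i, b^t_j)` whenever `x i j = true`; all pairs of distinct `A`-side vertices whose
indices both differ from `i*`; all pairs of distinct `B`-side vertices whose indices both
differ from `j*`; and the cross pairs `(a^t_i, b^{t'}_j)` with `t ≠ t'`, `i ≠ i*`, `j ≠ j*`.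
If `x i* j* = false`, then every maximal independent set `S` of this graph contains either
both `a^1_{i*}` and `b^1_{j*}`, or both `a^2_{i*}` and `b^2_{j*}`. -/
theorem mis_hard_instance (n : ℕ) (hn : 1 ≤ n) (x : Fin n → Fin n → Bool)
    (istar jstar : Fin n) (hx : x istar jstar = false)
    (G : SimpleGraph (Bool × Bool × Fin n))
    (hG : G = SimpleGraph.fromRel (fun u v =>
      (u.2.1 = false ∧ v.2.1 = false ∧ u.2.2 ≠ istar ∧ v.2.2 ≠ istar) ∨
      (u.2.1 = true ∧ v.2.1 = true ∧ u.2.2 ≠ jstar ∧ v.2.2 ≠ jstar) ∨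
      (u.2.1 = false ∧ v.2.1 = true ∧ u.1 = v.1 ∧ x u.2.2 v.2.2 = true) ∨
      (u.2.1 = false ∧ v.2.1 = true ∧ u.1 ≠ v.1 ∧ u.2.2 ≠ istar ∧ v.2.2 ≠ jstar)))
    (S : Set (Bool × Bool × Fin n))
    (hindep : ∀ u ∈ S, ∀ v ∈ S, ¬ G.Adj u v)
    (hmax : ∀ T : Set (Bool × Bool × Fin n),
      S ⊆ T → (∀ u ∈ T, ∀ v ∈ T, ¬ G.Adj u v) → T = S) :
    ((false, false, istar) ∈ S ∧ (false, true, jstar) ∈ S) ∨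
    ((true, false, istar) ∈ S ∧ (true, true, jstar) ∈ S) := by
  have key : ∀ t : Bool, ((t, false, istar) ∈ S ∧ (t, true, jstar) ∈ S) ∨
      (∃ i, i ≠ istar ∧ (t, false, i) ∈ S) ∨ ∃ j, j ≠ jstar ∧ (t, true, j) ∈ S := by
    intro t
    by_cases ha : (t, false, istar) ∈ S
    · by_cases hb : (t, true, jstar) ∈ S
      · exact Or.inl ⟨ha, hb⟩
      · obtain ⟨⟨s, c, i⟩, hu, hadj⟩ := exists_adj_of_notMem_of_maximal_indep hindep hmax hb
        rw [hG, SimpleGraph.fromRel_adj] at hadj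
        cases c <;> simp at hadj
        obtain ⟨rfl, hi⟩ := hadj
        exact Or.inr (Or.inl ⟨i, fun h => by simp [h, hx] at hi, hu⟩)
    · obtain ⟨⟨s, c, j⟩, hu, hadj⟩ := exists_adj_of_notMem_of_maximal_indep hindep hmax ha
      rw [hG, SimpleGraph.fromRel_adj] at hadj
      cases c <;> simp at hadj
      obtain ⟨rfl, hj⟩ := hadj
      exact Or.inr (Or.inr ⟨j, fun h => by simp [h, hx] at hj, hu⟩)
  rcases key false with h | h₁
  · exact Or.inl h
  rcases key true with h | h₂
  · exact Or.inr h
  exfalso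
  rcases h₁ with ⟨i, hi, hiS⟩ | ⟨i, hi, hiS⟩ <;> rcases h₂ with ⟨j, hj, hjS⟩ | ⟨j, hj, hjS⟩ <;>
  · refine hindep _ hiS _ hjS ?_
    rw [hG, SimpleGraph.fromRel_adj]
    simp [hi, hj]
end
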